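/- arXiv:1108.1900 — 2 statements merged into one kernel-verified Lean document; each statement's English description precedes it below -/
import Mathlib

section
/- Let A, X, B be nonconstant polynomials over ℂ such that A ∘ X = X ∘ B and X and B have no nontrivial common right compositional factor. Then the bivariate polynomial A(X) − X(Y) is irreducible in ℂ[X,Y]. -/
open Polynomial

/-- The local degree of a polynomial `p` at a point `z`: the multiplicity of `z`
as a root of `p(X) - p(z)`. -/
noncomputable def localDeg (p : Polynomial ℂ) (z : ℂ) : ℕ :=
  rootMultiplicity z (p - C (p.eval z))

/-- `p` and `q` have no nontrivial common right compositional factor. -/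
def NoCommonRightFactor (p q : Polynomial ℂ) : Prop :=
  ∀ p₁ q₁ W : Polynomial ℂ, p = p₁.comp W → q = q₁.comp W → W.natDegree ≤ 1

/-- The bivariate polynomial `f(X) - g(Y)`, viewed as an element of `(ℂ[X])[Y]`. -/
noncomputable def curvePoly (f g : Polynomial ℂ) : Polynomial (Polynomial ℂ) :=
  C f - g.map C

open IntermediateField

section

variable {K : Type*} [Field K]

/-- The substitution `t ↦ s`, `T ↦ u s` from `K[t][T]` to `K[u][s]`, under which the degree
in `s` records the total degree. -/
noncomputable def totalDegreeHom : K[X][X] →+* K[X][X] :=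
  eval₂RingHom (mapRingHom C) (X * C X)

lemma coeff_coeff_totalDegreeHom (M : K[X][X]) (n j : ℕ) :
    ((totalDegreeHom M).coeff (n + j)).coeff j = (M.coeff j).coeff n := by
  induction M using Polynomial.induction_on' with
  | add p q hp hq => simp [hp, hq]
  | monomial i a =>
    have h : totalDegreeHom (monomial i a) = a.map C * C (X ^ i) * X ^ i := by
      rw [totalDegreeHom, coe_eval₂RingHom, eval₂_monomial, coe_mapRingHom, mul_pow, C_pow]
      ring
    rw [h, coeff_mul_X_pow']
    by_cases hij : i = j
    · subst hij
      rw [if_pos (Nat.le_add_left i n), Nat.add_sub_cancel, coeff_mul_C, coeff_map, coeff_monomial,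
        if_pos rfl]
      simp
    · split_ifs with hle
      · rw [coeff_mul_C, coeff_map, coeff_C_mul, coeff_X_pow, coeff_monomial]
        simp [hij, Ne.symm hij]
      · simp [coeff_monomial, hij]

lemma le_natDegree_totalDegreeHom {M : K[X][X]} {n j : ℕ} (h : (M.coeff j).coeff n ≠ 0) :
    n + j ≤ (totalDegreeHom M).natDegree := by
  refine le_natDegree_of_ne_zero fun h0 => h ?_
  rw [← coeff_coeff_totalDegreeHom, h0, coeff_zero]

lemma Polynomial.Monic.natDegree_le_natDegree_totalDegreeHom {M : K[X][X]} (hM : M.Monic) :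
    M.natDegree ≤ (totalDegreeHom M).natDegree := by
  simpa using le_natDegree_totalDegreeHom (M := M) (n := 0) (j := M.natDegree)
    (by simp [hM.coeff_natDegree])

lemma natDegree_coeff_le_of_mul {M Q : K[X][X]} (hM : M.Monic) (hQ : Q.Monic)
    (h : (totalDegreeHom (M * Q)).natDegree ≤ (M * Q).natDegree) (j : ℕ) :
    (M.coeff j).natDegree ≤ M.natDegree := by
  have hM' := hM.natDegree_le_natDegree_totalDegreeHom
  have hQ' := hQ.natDegree_le_natDegree_totalDegreeHom
  have ne : ∀ {P : K[X][X]}, P.Monic → totalDegreeHom P ≠ 0 := by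
    intro P hP h0
    have := coeff_coeff_totalDegreeHom P 0 P.natDegree
    simp [h0, hP.coeff_natDegree] at this
  rw [map_mul, natDegree_mul (ne hM) (ne hQ), hM.natDegree_mul hQ] at h
  by_cases hj : M.coeff j = 0
  · simp [hj]
  · have := le_natDegree_totalDegreeHom (M := M) (j := j) (n := (M.coeff j).natDegree)
      (by simpa using hj)
    omega

lemma natDegree_totalDegreeHom_sub_le (p : K[X]) :
    (totalDegreeHom (p.map C - C p)).natDegree ≤ p.natDegree := by
  have h : totalDegreeHom (p.map C - C p) = p.eval₂ (C.comp C) (X * C X) - p.map C := by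
    have hC : (mapRingHom C).comp C = (C.comp C : K →+* K[X][X]) := by ext; simp
    rw [totalDegreeHom, coe_eval₂RingHom, eval₂_sub, eval₂_map, hC, eval₂_C, coe_mapRingHom]
  rw [h]
  refine (natDegree_sub_le _ _).trans (max_le ?_ (natDegree_map_le ..))
  rw [eval₂_eq_sum]
  refine natDegree_sum_le_of_forall_le _ _ fun i hi => ?_
  change (C.comp C (p.coeff i) * (X * C X) ^ i).natDegree ≤ _
  rw [mul_pow, ← C_pow, RingHom.comp_apply]
  refine (natDegree_C_mul_le _ _).trans ((natDegree_mul_C_le _ _).trans ?_)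
  simpa using le_natDegree_of_mem_supp i hi

lemma exists_comp_eq_of_mem_adjoin {p W : K[X]} (hW : 0 < W.natDegree)
    (h : algebraMap K[X] (RatFunc K) p ∈ K⟮algebraMap K[X] (RatFunc K) W⟯) :
    ∃ q : K[X], p = q.comp W := by
  have hinj := RatFunc.algebraMap_injective K
  have hcomp : ∀ r : K[X], aeval (algebraMap K[X] (RatFunc K) W) r =
      algebraMap K[X] (RatFunc K) (r.comp W) := fun r => by
    rw [aeval_algebraMap_apply]; rfl
  obtain ⟨r, s, hrs⟩ := (mem_adjoin_simple_iff K _).1 h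
  by_cases hs : s = 0
  · refine ⟨0, hinj ?_⟩
    simp [hrs, hs]
  set f := algebraMap K[X] (RatFunc K) r / algebraMap K[X] (RatFunc K) s with hf
  have hc := RatFunc.isCoprime_num_denom f
  have hs0 := RatFunc.denom_ne_zero f
  have hnd : f.num * s = r * f.denom := (RatFunc.num_mul_eq_mul_denom_iff hs).2 hf
  generalize f.num = r' at hc hnd
  generalize f.denom = s' at hc hs0 hnd
  have hne : ∀ {f : K[X]}, f ≠ 0 → f.comp W ≠ 0 := by
    intro f hf h0
    rcases comp_eq_zero_iff.1 h0 with h1 | h1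
    · exact hf h1
    · rw [h1.2] at hW; simp at hW
  have hmul : p * s'.comp W = r'.comp W := by
    apply mul_right_cancel₀ (hne hs)
    rw [hcomp, hcomp, eq_div_iff (by simpa using hne hs), ← map_mul] at hrs
    have hps := hinj hrs
    have hnd' := congrArg (fun f => f.comp W) hnd
    simp only [mul_comp] at hnd'
    linear_combination s'.comp W * hps - hnd'
  obtain ⟨a, b, hab⟩ := hc
  have hu : IsUnit (s'.comp W) := by
    refine IsUnit.of_mul_eq_one (a.comp W * p + b.comp W) ?_
    have := congrArg (fun f => f.comp W) hab
    simp only [add_comp, mul_comp, one_comp] at this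
    linear_combination this + a.comp W * hmul
  have hd : s'.natDegree = 0 := by
    have := natDegree_eq_zero_of_isUnit hu
    rw [natDegree_comp] at this
    rcases Nat.mul_eq_zero.1 this with h1 | h1
    · exact h1
    · omega
  obtain ⟨c, rfl⟩ := natDegree_eq_zero.1 hd
  have hc0 : c ≠ 0 := by simpa using hs0
  refine ⟨C c⁻¹ * r', ?_⟩
  rw [mul_comp, ← hmul, C_comp, C_comp, mul_left_comm, ← C_mul, inv_mul_cancel₀ hc0, C_1, mul_one]

lemma algebraMap_ne_C {p : K[X]} (hp : 0 < p.natDegree) :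
    ¬∃ c, algebraMap K[X] (RatFunc K) p = RatFunc.C c := by
  rintro ⟨c, hc⟩
  rw [← RatFunc.algebraMap_C] at hc
  rw [RatFunc.algebraMap_injective K hc] at hp
  simp at hp

lemma finrank_adjoin_algebraMap (p : K[X]) :
    Module.finrank K⟮algebraMap K[X] (RatFunc K) p⟯ (RatFunc K) = p.natDegree := by
  rw [RatFunc.finrank_eq_max_natDegree]
  simp

/-- Lüroth's theorem for intermediate fields containing a nonconstant polynomial. -/
lemma exists_eq_adjoin_algebraMap (E : IntermediateField K (RatFunc K)) {p : K[X]}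
    (hp : 0 < p.natDegree) (hpE : algebraMap K[X] (RatFunc K) p ∈ E) :
    ∃ W : K[X], 0 < W.natDegree ∧ Module.finrank E (RatFunc K) = W.natDegree ∧
      E = K⟮algebraMap K[X] (RatFunc K) W⟯ := by
  wlog hmon : p.Monic generalizing p
  · have hp0 : p ≠ 0 := by rintro rfl; simp at hp
    refine this (p := C p.leadingCoeff⁻¹ * p) ?_ ?_ ?_
    · rwa [natDegree_C_mul (by simpa using hp0)]
    · rw [map_mul]
      refine mul_mem ?_ hpE
      simpa using E.algebraMap_mem p.leadingCoeff⁻¹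
    · rw [mul_comm]; exact monic_mul_leadingCoeff_inv hp0
  have hbot : E ≠ ⊥ := by
    rintro rfl
    obtain ⟨c, hc⟩ := mem_bot.1 hpE
    exact algebraMap_ne_C hp ⟨c, hc.symm⟩
  have hint := (RatFunc.IntermediateField.isAlgebraic_X hbot).isIntegral
  set φ := minpoly E (RatFunc.X : RatFunc K)
  have hφm : φ.Monic := minpoly.monic hint
  have hφd : φ.natDegree = Module.finrank E (RatFunc K) := by
    rw [← (RatFunc.IntermediateField.adjoinXEquiv E).toLinearEquiv.finrank_eq,
      adjoin.finrank hint]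
  set F : K[X][X] := p.map C - C p with hF
  have hFdeg : (C p : K[X][X]).degree < (p.map C).degree := by
    rw [degree_map]
    exact degree_C_le.trans_lt (natDegree_pos_iff_degree_pos.1 hp)
  have hFm : F.Monic := (hmon.map C).sub_of_left hFdeg
  have hFd : F.natDegree = p.natDegree := by
    rw [hF, natDegree_sub_eq_left_of_natDegree_lt] <;> simp [hp]
  have hdvdF : φ.map (algebraMap E (RatFunc K)) ∣ F.map (algebraMap K[X] (RatFunc K)) := by
    have h : F.map (algebraMap K[X] (RatFunc K)) =
        (p.map (algebraMap K E) - C (⟨_, hpE⟩ : E)).map (algebraMap E (RatFunc K)) := by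
      rw [hF, Polynomial.map_sub, Polynomial.map_sub, Polynomial.map_map, Polynomial.map_map,
        map_C, map_C]
      rfl
    rw [h]
    apply Polynomial.map_dvd
    apply minpoly.dvd
    rw [map_sub, aeval_map_algebraMap, aeval_C, ← RatFunc.algebraMap_X, aeval_algebraMap_apply]
    simp
  obtain ⟨M, hM⟩ := IsIntegrallyClosed.eq_map_mul_C_of_dvd (RatFunc K) hFm hdvdF
  rw [(hφm.map _).leadingCoeff, C_1, mul_one] at hM
  have hinj := RatFunc.algebraMap_injective K
  have hMm : M.Monic := by
    apply monic_of_injective hinj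
    rw [hM]; exact hφm.map _
  have hMd : M.natDegree = φ.natDegree := by
    rw [← natDegree_map_eq_of_injective hinj, hM, natDegree_map]
  have hMF : M ∣ F := by
    rw [← hM] at hdvdF
    exact (map_dvd_map _ hinj hMm).1 hdvdF
  obtain ⟨Q, hQ⟩ := hMF
  have hQm : Q.Monic := hMm.of_mul_monic_left (hQ ▸ hFm)
  have hMc : ∀ j, (M.coeff j).natDegree ≤ M.natDegree := by
    apply natDegree_coeff_le_of_mul hMm hQm
    rw [← hQ, hFd]
    exact natDegree_totalDegreeHom_sub_le p
  have hcoeff : ∀ j, algebraMap K[X] (RatFunc K) (M.coeff j) = φ.coeff j := by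
    intro j
    rw [← coeff_map, hM, coeff_map]; rfl
  obtain ⟨j, hj⟩ : ∃ j, 0 < (M.coeff j).natDegree := by
    by_contra! hcon
    have hlift : (M.map (constantCoeff)).map C = M := by
      ext1 j
      rw [coeff_map, coeff_map]
      exact (eq_C_of_natDegree_le_zero (hcon j)).symm
    apply RatFunc.transcendental_X (K := K)
    refine ⟨M.map constantCoeff, fun h0 => hMm.ne_zero ?_, ?_⟩
    · rw [← hlift, h0, Polynomial.map_zero]
    · have h1 : aeval (RatFunc.X : RatFunc K) φ = 0 := minpoly.aeval _ _
      rw [aeval_def, ← eval_map, ← hM, ← hlift, Polynomial.map_map, eval_map] at h1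
      exact h1
  refine ⟨M.coeff j, hj, ?_⟩
  have hle : K⟮algebraMap K[X] (RatFunc K) (M.coeff j)⟯ ≤ E := by
    rw [adjoin_simple_le_iff, hcoeff]
    exact (φ.coeff j).2
  have : FiniteDimensional K⟮algebraMap K[X] (RatFunc K) (M.coeff j)⟯ (RatFunc K) := by
    apply Module.finite_of_finrank_pos
    rwa [finrank_adjoin_algebraMap]
  have heq : K⟮algebraMap K[X] (RatFunc K) (M.coeff j)⟯ = E := by
    apply eq_of_le_of_finrank_le' hle
    rw [finrank_adjoin_algebraMap, ← hφd, ← hMd]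
    exact hMc j
  refine ⟨?_, heq.symm⟩
  rw [← heq, finrank_adjoin_algebraMap]

end

lemma NoCommonRightFactor.adjoin_eq_top {p q : ℂ[X]} (h : NoCommonRightFactor p q)
    (hp : 0 < p.natDegree) :
    IntermediateField.adjoin ℂ
      {algebraMap ℂ[X] (RatFunc ℂ) p, algebraMap ℂ[X] (RatFunc ℂ) q} = ⊤ := by
  obtain ⟨W, hW, hrank, hE⟩ := exists_eq_adjoin_algebraMap
    (IntermediateField.adjoin ℂ {algebraMap ℂ[X] (RatFunc ℂ) p, algebraMap ℂ[X] (RatFunc ℂ) q}) hp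
    (subset_adjoin _ _ (by simp))
  obtain ⟨p₁, hp₁⟩ := exists_comp_eq_of_mem_adjoin (p := p) hW (hE ▸ subset_adjoin _ _ (by simp))
  obtain ⟨q₁, hq₁⟩ := exists_comp_eq_of_mem_adjoin (p := q) hW (hE ▸ subset_adjoin _ _ (by simp))
  have := h p₁ q₁ W hp₁ hq₁
  rw [← finrank_eq_one_iff_eq_top, hrank]
  omega

lemma NoCommonRightFactor.natDegree_le {p q : ℂ[X]} (h : NoCommonRightFactor p q)
    (hp : 0 < p.natDegree) {G : ℂ[X][X]} (hG : G ≠ 0)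
    (hroot : G.eval₂ (compRingHom p) q = 0) : p.natDegree ≤ G.natDegree := by
  set x := algebraMap ℂ[X] (RatFunc ℂ) p with hx
  set y := algebraMap ℂ[X] (RatFunc ℂ) q with hy
  have hfin : FiniteDimensional ℂ⟮x⟯ (RatFunc ℂ) := by
    apply Module.finite_of_finrank_pos
    rwa [finrank_adjoin_algebraMap]
  have htop : ℂ⟮x⟯⟮y⟯ = ⊤ := by
    rw [← restrictScalars_eq_top_iff (K := ℂ), adjoin_simple_adjoin_simple]
    exact h.adjoin_eq_top hp
  have hmin : (minpoly ℂ⟮x⟯ y).natDegree = p.natDegree := by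
    rw [← adjoin.finrank (IsIntegral.of_finite _ y), htop, IntermediateField.finrank_top',
      finrank_adjoin_algebraMap]
  let ψ : ℂ[X] →+* ℂ⟮x⟯ := (aeval (AdjoinSimple.gen ℂ x)).toRingHom
  have hψ : ∀ r, algebraMap ℂ⟮x⟯ (RatFunc ℂ) (ψ r) = algebraMap ℂ[X] (RatFunc ℂ) (r.comp p) := by
    intro r
    change algebraMap ℂ⟮x⟯ (RatFunc ℂ) (aeval (AdjoinSimple.gen ℂ x) r) = _
    rw [← aeval_algebraMap_apply, AdjoinSimple.algebraMap_gen, hx, aeval_algebraMap_apply]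
    rfl
  have hψinj : Function.Injective ψ := by
    rw [injective_iff_map_eq_zero]
    intro r hr
    have h0 := hψ r
    rw [hr, map_zero, eq_comm, map_eq_zero_iff _ (RatFunc.algebraMap_injective ℂ)] at h0
    rcases comp_eq_zero_iff.1 h0 with h1 | h1
    · exact h1
    · rw [h1.2] at hp; simp at hp
  rw [← hmin, ← natDegree_map_eq_of_injective hψinj]
  apply natDegree_le_of_dvd
  · apply minpoly.dvd
    have hcomp : (algebraMap ℂ⟮x⟯ (RatFunc ℂ)).comp ψ =
        (algebraMap ℂ[X] (RatFunc ℂ)).comp (compRingHom p) := RingHom.ext hψ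
    rw [aeval_def, eval₂_map, hcomp, hy, ← hom_eval₂, hroot, map_zero]
  · rwa [Ne, Polynomial.map_eq_zero_iff hψinj]

theorem stmt_4 (A X B : Polynomial ℂ)
    (hA : 0 < A.natDegree) (hX : 0 < X.natDegree) (hB : 0 < B.natDegree)
    (heq : A.comp X = X.comp B)
    (hnc : NoCommonRightFactor X B) :
    Irreducible (curvePoly A X) := by
  have hdeg : (curvePoly A X).natDegree = X.natDegree := by
    rw [curvePoly, natDegree_sub_eq_right_of_natDegree_lt] <;> simp [hX]
  have hlead : IsUnit (curvePoly A X).leadingCoeff := by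
    rw [leadingCoeff, hdeg, curvePoly, coeff_sub, coeff_C, if_neg hX.ne', zero_sub, coeff_map,
      coeff_natDegree, IsUnit.neg_iff, isUnit_C, isUnit_iff_ne_zero, leadingCoeff_ne_zero]
    rintro rfl
    simp at hX
  have hne : curvePoly A X ≠ 0 := by
    intro h0
    rw [h0] at hdeg
    simp at hdeg
    omega
  have hroot : (curvePoly A X).eval₂ (compRingHom X) B = 0 := by
    have h : (compRingHom X).comp (C : ℂ →+* ℂ[X]) = C := by ext; simp
    rw [curvePoly, eval₂_sub, eval₂_C, eval₂_map, h]
    exact sub_eq_zero.2 heq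
  have key : ∀ G H : ℂ[X][X], curvePoly A X = G * H → G.eval₂ (compRingHom X) B = 0 →
      IsUnit H := by
    intro G H hGH hG
    have hGH0 : G ≠ 0 ∧ H ≠ 0 := mul_ne_zero_iff.1 (hGH ▸ hne)
    have hle := hnc.natDegree_le hX hGH0.1 hG
    rw [hGH, natDegree_mul hGH0.1 hGH0.2] at hdeg
    obtain ⟨c, rfl⟩ := natDegree_eq_zero.1 (by omega : H.natDegree = 0)
    rw [hGH, leadingCoeff_mul, leadingCoeff_C] at hlead
    exact isUnit_C.2 (isUnit_of_mul_isUnit_right hlead)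
  refine ⟨fun hu => ?_, fun G H hGH => ?_⟩
  · have := natDegree_eq_zero_of_isUnit hu
    omega
  · have h := hroot
    rw [hGH, eval₂_mul, mul_eq_zero] at h
    rcases h with h | h
    · exact Or.inr (key G H hGH h)
    · exact Or.inl (key H G (by rw [hGH, mul_comm]) h)
end

section
/- Let f, g, p, q be nonconstant polynomials over ℂ such that f ∘ p = g ∘ q, the bivariate polynomial f(X) − g(Y) is irreducible in ℂ[X,Y], and p and q have no nontrivial common right compositional factor. For a nonconstant polynomial h and w ∈ ℂ, let ν_h(w) denote the least common multiple of the local degrees e_u(h) over all u in the fiber h⁻¹(w), and for u ∈ ℂ set ν¹_h(u) = ν_h(h(u)) / e_u(h) (a natural number, since e_u(h) divides ν_h(h(u))). Then for every z ∈ ℂ: ν¹_f(p(z)) = ν¹_q(z) · gcd(e_z(p), ν¹_f(p(z))). -/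
open Polynomial

/-- `ν_h(w)`: the least common multiple of the local degrees of `h` over the fiber
`h⁻¹(w)`. -/
noncomputable def nuPoly (h : Polynomial ℂ) (w : ℂ) : ℕ :=
  ((h - C w).roots.toFinset).lcm (localDeg h)

/-- `ν¹_h(u) = ν_h(h(u)) / e_u(h)`. -/
noncomputable def nuOnePoly (h : Polynomial ℂ) (u : ℂ) : ℕ :=
  nuPoly h (h.eval u) / localDeg h u

/-- Expansion of a nonconstant polynomial at a point, with exponent the local degree. -/
theorem exists_eq_add_pow_localDeg_mul {p : ℂ[X]} (hp : 0 < p.natDegree) (z : ℂ) :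
    ∃ P : ℂ[X], p = C (p.eval z) + (X - C z) ^ localDeg p z * P ∧ P.eval z ≠ 0 := by
  have h0 : p - C (p.eval z) ≠ 0 := by
    intro h
    rw [sub_eq_zero.mp h, natDegree_C] at hp
    exact hp.false
  obtain ⟨P, hP, hnd⟩ := exists_eq_pow_rootMultiplicity_mul_and_not_dvd _ h0 z
  exact ⟨P, by rw [localDeg, ← hP]; ring, fun h ↦ hnd (dvd_iff_isRoot.mpr h)⟩

theorem localDeg_pos {p : ℂ[X]} (hp : 0 < p.natDegree) (z : ℂ) : 0 < localDeg p z := by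
  obtain ⟨P, hP, hz⟩ := exists_eq_add_pow_localDeg_mul hp z
  by_contra h
  obtain h : localDeg p z = 0 := by lia
  have := congrArg (eval z) hP
  simp [h] at this
  exact hz this

theorem localDeg_eq_of_eq_add_pow_mul {p P : ℂ[X]} {c z : ℂ} {n : ℕ} (hn : 0 < n)
    (h : p = C c + (X - C z) ^ n * P) (hP : P.eval z ≠ 0) : localDeg p z = n := by
  have hz : p.eval z = c := by simp [h, hn.ne']
  have hP0 : P ≠ 0 := by rintro rfl; simp at hP
  have h1 : p - C (p.eval z) = (X - C z) ^ n * P := by rw [hz, h]; ring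
  have h2 : (X - C z) ^ n * P ≠ 0 := mul_ne_zero (pow_ne_zero _ (X_sub_C_ne_zero z)) hP0
  rw [localDeg, h1, rootMultiplicity_mul h2, rootMultiplicity_X_sub_C_pow,
    rootMultiplicity_eq_zero hP, add_zero]

theorem localDeg_comp {f p : ℂ[X]} (hf : 0 < f.natDegree) (hp : 0 < p.natDegree) (z : ℂ) :
    localDeg (f.comp p) z = localDeg f (p.eval z) * localDeg p z := by
  obtain ⟨P, hP, hPz⟩ := exists_eq_add_pow_localDeg_mul hp z
  obtain ⟨F, hF, hFz⟩ := exists_eq_add_pow_localDeg_mul hf (p.eval z)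
  set x := p.eval z
  set a := localDeg f x
  set e := localDeg p z
  have hpx : p - C x = (X - C z) ^ e * P := by
    rw [sub_eq_iff_eq_add']; exact hP
  refine localDeg_eq_of_eq_add_pow_mul (c := f.eval x) (P := P ^ a * F.comp p)
    (Nat.mul_pos (localDeg_pos hf x) (localDeg_pos hp z)) ?_ ?_
  · conv_lhs => rw [hF]
    simp only [add_comp, mul_comp, pow_comp, sub_comp, C_comp, X_comp]
    rw [hpx]
    ring
  · simp only [eval_mul, eval_pow, eval_comp]
    exact mul_ne_zero (pow_ne_zero _ hPz) hFz

theorem constantCoeff_aeval_X_mul (u : PowerSeries ℂ) (P : ℂ[X]) :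
    PowerSeries.constantCoeff (aeval (PowerSeries.X * u) P) = P.coeff 0 := by
  rw [aeval_eq_sum_range, Finset.sum_range_succ']
  simp

/-- Hensel's lemma for the equation `u ^ e * P (t * u) = P t` in the power series ring `ℂ⟦t⟧`. -/
theorem exists_series_pow_mul_aeval_eq {P : ℂ[X]} (hP : P.coeff 0 ≠ 0) {e : ℕ} (he : 0 < e)
    {ζ : ℂ} (hζ : ζ ^ e = 1) :
    ∃ u : PowerSeries ℂ, PowerSeries.constantCoeff u = ζ ∧
      u ^ e * aeval (PowerSeries.X * u) P = aeval (PowerSeries.X : PowerSeries ℂ) P := by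
  have hζ0 : ζ ≠ 0 := by rintro rfl; simp [he.ne'] at hζ
  set m := P.natDegree with hm
  have hU : IsUnit (aeval (PowerSeries.X : PowerSeries ℂ) P) := by
    rw [PowerSeries.isUnit_iff_constantCoeff, aeval_eq_sum_range, Finset.sum_range_succ']
    simpa using hP
  obtain ⟨V, hV⟩ := hU.exists_right_inv
  have hVc : PowerSeries.constantCoeff V * P.coeff 0 = 1 := by
    have := congrArg PowerSeries.constantCoeff hV
    rw [aeval_eq_sum_range, Finset.sum_range_succ'] at this
    simpa [mul_comm] using this
  set N : (PowerSeries ℂ)[X] :=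
    ∑ j ∈ Finset.range (m + 1), C (P.coeff j • (PowerSeries.X : PowerSeries ℂ) ^ j) * X ^ (m - j)
    with hN
  have hNeval (x u : PowerSeries ℂ) (hxu : x * u = 1) :
      N.eval x = x ^ m * aeval (PowerSeries.X * u) P := by
    rw [aeval_eq_sum_range, hN, eval_finsetSum, Finset.mul_sum]
    refine Finset.sum_congr rfl fun j hj ↦ ?_
    have hj : j ≤ m := by simpa [Nat.lt_succ_iff] using hj
    obtain ⟨k, hk⟩ := Nat.exists_eq_add_of_le hj
    have h1 : x ^ j * u ^ j = 1 := by rw [← mul_pow, hxu, one_pow]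
    simp only [hk, Nat.add_sub_cancel_left, eval_mul, eval_C, eval_pow, eval_X,
      PowerSeries.smul_eq_C_mul]
    linear_combination (-PowerSeries.C (P.coeff j) * PowerSeries.X ^ j * x ^ k) * h1
  have hNdeg : degree (C V * N) ≤ m := by
    rw [← smul_eq_C_mul]
    refine (degree_smul_le _ _).trans ((degree_sum_le _ _).trans (Finset.sup_le fun j _ ↦
      (degree_C_mul_X_pow_le _ _).trans ?_))
    exact_mod_cast Nat.sub_le m j
  set G : (PowerSeries ℂ)[X] := X ^ (e + m) - C V * N with hG
  have hGm : G.Monic :=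
    monic_X_pow_sub (hNdeg.trans_lt (by exact_mod_cast (by lia : m < e + m)))
  have hGmap : G.map (PowerSeries.constantCoeff (R := ℂ)) = X ^ (e + m) - X ^ m := by
    rw [hG, hN, Finset.sum_range_succ']
    simp only [Polynomial.map_sub, Polynomial.map_mul, Polynomial.map_add, Polynomial.map_sum,
      Polynomial.map_pow, map_C, map_X, PowerSeries.smul_eq_C_mul, map_mul, map_pow,
      PowerSeries.constantCoeff_X, PowerSeries.constantCoeff_C]
    simp [← mul_assoc, ← C_mul, hVc]
  have hccG (Q : (PowerSeries ℂ)[X]) (a : ℂ) :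
      PowerSeries.constantCoeff (Q.eval (PowerSeries.C a)) =
        (Q.map (PowerSeries.constantCoeff (R := ℂ))).eval a := by
    rw [eval_map, ← eval₂_hom]; simp
  have hx : (ζ⁻¹) ^ e = 1 := by simp [hζ]
  obtain ⟨x, hxr, hxm⟩ := HenselianRing.is_henselian
    (I := Ideal.span {(PowerSeries.X : PowerSeries ℂ)}) G hGm (PowerSeries.C ζ⁻¹)
    (by
      rw [Ideal.mem_span_singleton, PowerSeries.X_dvd_iff, hccG, hGmap]
      simp [pow_add, hζ])
    (by
      refine IsUnit.map _ ?_
      rw [PowerSeries.isUnit_iff_constantCoeff, hccG, ← derivative_map, hGmap, pow_add,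
        ← sub_one_mul, derivative_mul]
      simp [derivative_X_pow, hζ, hζ0, he.ne'])
  have hxc : PowerSeries.constantCoeff x = ζ⁻¹ := by
    rw [Ideal.mem_span_singleton, PowerSeries.X_dvd_iff] at hxm
    simpa [sub_eq_zero] using hxm
  have hxu : IsUnit x := by
    rw [PowerSeries.isUnit_iff_constantCoeff, hxc]; simp [hζ0]
  obtain ⟨u, hu⟩ := hxu.exists_right_inv
  refine ⟨u, ?_, ?_⟩
  · have := congrArg PowerSeries.constantCoeff hu
    rw [map_mul, hxc] at this
    field_simp at this
    simpa using this
  · have h1 : x ^ (e + m) - V * (x ^ m * aeval (PowerSeries.X * u) P) = 0 := by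
      rw [← hNeval x u hu]
      simpa [hG, IsRoot] using hxr
    have h2 : x ^ m ≠ 0 := (hxu.pow m).ne_zero
    have h3 : x ^ e = V * aeval (PowerSeries.X * u) P :=
      mul_left_cancel₀ h2 (by linear_combination h1)
    have h4 : u ^ e * x ^ e = 1 := by rw [← mul_pow, mul_comm u, hu, one_pow]
    linear_combination (-u ^ e * aeval (PowerSeries.X * u) P) * hV
      + (-u ^ e * aeval PowerSeries.X P) * h3 + aeval (PowerSeries.X : PowerSeries ℂ) P * h4

/-- Uniqueness of simple roots in `ℂ⟦t⟧` for the equation `u ^ n * H (t * u) = c`. -/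
theorem series_eq_of_pow_mul_aeval_eq {H : ℂ[X]} (hH : H.coeff 0 ≠ 0) {n : ℕ} (hn : 0 < n)
    {u v : PowerSeries ℂ} (hu : PowerSeries.constantCoeff u ≠ 0)
    (huv : PowerSeries.constantCoeff u = PowerSeries.constantCoeff v)
    (h : u ^ n * aeval (PowerSeries.X * u) H = v ^ n * aeval (PowerSeries.X * v) H) : u = v := by
  have hHe (y : PowerSeries ℂ) : (H.map PowerSeries.C).eval y = aeval y H := by
    rw [eval_map]; rfl
  set G : (PowerSeries ℂ)[X] :=
    X ^ n * (H.map PowerSeries.C).comp (C PowerSeries.X * X) with hG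
  have hGe (x : PowerSeries ℂ) : G.eval x = x ^ n * aeval (PowerSeries.X * x) H := by
    simp [hG, eval_comp, hHe]
  obtain ⟨k, hk⟩ := G.binomExpansion u (v - u)
  rw [add_sub_cancel, hGe, hGe, h] at hk
  have h0 : (G.derivative.eval u + k * (v - u)) * (v - u) = 0 := by linear_combination -hk
  rcases mul_eq_zero.mp h0 with h1 | h1
  · exfalso
    have h2 := congrArg PowerSeries.constantCoeff h1
    rw [hG, derivative_mul, derivative_comp] at h2
    simp [eval_comp, hHe, derivative_X_pow, constantCoeff_aeval_X_mul, ← huv, hH, hn.ne', hu] at h2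
  · exact (sub_eq_zero.mp h1).symm

/-- An element of the subfield generated by a nonconstant polynomial `W` that is itself a
polynomial is a polynomial in `W`. -/
theorem exists_eq_comp_of_mem_adjoin {K : Type*} [Field K] {W s : K[X]} (hW : W.natDegree ≠ 0)
    (hs : algebraMap K[X] (RatFunc K) s ∈
      IntermediateField.adjoin K {algebraMap K[X] (RatFunc K) W}) :
    ∃ s₁ : K[X], s = s₁.comp W := by
  rcases eq_or_ne s 0 with rfl | hs0
  · exact ⟨0, by simp⟩
  obtain ⟨U, V, hUV⟩ := (IntermediateField.mem_adjoin_simple_iff _ _).mp hs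
  have hinj : Function.Injective (algebraMap K[X] (RatFunc K)) := RatFunc.algebraMap_injective K
  have hcomp (A : K[X]) : aeval (algebraMap K[X] (RatFunc K) W) A =
      algebraMap K[X] (RatFunc K) (A.comp W) := by
    rw [aeval_algebraMap_apply, comp_eq_aeval]
  rw [hcomp, hcomp] at hUV
  have hV0 : V.comp W ≠ 0 := by
    intro h
    rw [h, map_zero, div_zero] at hUV
    exact hs0 (hinj (by simpa using hUV))
  have hUV' : s * V.comp W = U.comp W := by
    apply hinj
    rw [map_mul, hUV, div_mul_cancel₀ _ ((map_ne_zero_iff _ hinj).mpr hV0)]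
  have hVne : V ≠ 0 := by rintro rfl; simp at hV0
  obtain ⟨U₁, V₁, g, hco, hU, hV⟩ := UniqueFactorizationMonoid.exists_reduced_factors' U V hVne
  have hgW : g.comp W ≠ 0 := by
    intro h
    rw [← hV, mul_comp, h, zero_mul] at hV0
    exact hV0 rfl
  have h1 : s * V₁.comp W = U₁.comp W := by
    apply mul_left_cancel₀ hgW
    rw [← mul_comp, hU, ← hUV', mul_left_comm, ← mul_comp, hV]
  obtain ⟨α, β, hαβ⟩ := hco.isCoprime
  have h2 : IsUnit (V₁.comp W) := by
    refine IsUnit.of_mul_eq_one (α.comp W * s + β.comp W) ?_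
    have := congrArg (fun A ↦ A.comp W) hαβ
    simp only [add_comp, mul_comp, one_comp, ← h1] at this
    linear_combination this
  have h3 : V₁.natDegree = 0 := by
    have := natDegree_eq_zero_of_isUnit h2
    rw [natDegree_comp] at this
    exact (Nat.mul_eq_zero.mp this).resolve_right hW
  obtain ⟨c, rfl⟩ := natDegree_eq_zero.mp h3
  rw [C_comp] at h1 h2
  have hc : c ≠ 0 := by rintro rfl; simp at h2
  refine ⟨C c⁻¹ * U₁, ?_⟩
  rw [mul_comp, C_comp, ← h1, mul_left_comm, ← C_mul, inv_mul_cancel₀ hc, C_1, mul_one]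

theorem eq_zero_of_C_mul_eq_C {K : Type*} [Field K] {W : K[X]} (hW : W.natDegree ≠ 0)
    {a b : K} (h : C a * W = C b) : a = 0 ∧ b = 0 := by
  have ha : a = 0 := by
    by_contra ha
    have := congrArg natDegree h
    rw [natDegree_C_mul ha, natDegree_C] at this
    exact hW this
  subst ha
  exact ⟨rfl, by simpa using h.symm⟩

open IntermediateField.algebraAdjoinAdjoin in
/-- **Lüroth's theorem for polynomials**: a subfield of `K(X)` that contains a nonconstant
polynomial is generated by a polynomial. -/
theorem exists_polynomial_eq_adjoin {K : Type*} [Field K]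
    (D : IntermediateField K (RatFunc K)) {p : K[X]}
    (hp : p.natDegree ≠ 0) (hpD : algebraMap K[X] (RatFunc K) p ∈ D) :
    ∃ W : K[X], W.natDegree ≠ 0 ∧
      D = IntermediateField.adjoin K {algebraMap K[X] (RatFunc K) W} := by
  have hinj : Function.Injective (algebraMap K[X] (RatFunc K)) := RatFunc.algebraMap_injective K
  have hbot : D ≠ ⊥ := by
    rintro rfl
    obtain ⟨c, hc⟩ := IntermediateField.mem_bot.mp hpD
    rw [IsScalarTower.algebraMap_apply K K[X] (RatFunc K)] at hc
    rw [← hinj hc] at hp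
    simp at hp
  set r := RatFunc.Luroth.generator D with hr
  have hDr : D = IntermediateField.adjoin K {r} := RatFunc.Luroth.eq_adjoin_generator
  have hrC : ¬∃ c, r = RatFunc.C c := RatFunc.Luroth.generator_ne_C hbot
  have hrD : r ∈ D := RatFunc.Luroth.generator_mem
  set M : (RatFunc K)[X] := r.minpolyX (RatFunc K) with hM
  have hMcoeff (i : ℕ) : M.coeff i =
      algebraMap K[X] (RatFunc K) (C (r.num.coeff i)) -
        r * algebraMap K[X] (RatFunc K) (C (r.denom.coeff i)) := by
    simp [hM, RatFunc.minpolyX]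
  have hmap : (r.minpolyX (IntermediateField.adjoin K {r})).map
      (algebraMap (IntermediateField.adjoin K {r}) (RatFunc K)) = M := r.minpolyX_map _ _
  have hm0 : r.minpolyX (IntermediateField.adjoin K {r}) ≠ 0 :=
    fun h ↦ hrC (r.minpolyX_eq_zero_iff.mp h)
  have hM0 : M ≠ 0 := by
    rw [← hmap]
    exact (Polynomial.map_ne_zero_iff (RingHom.injective _)).mpr hm0
  have hMX : M.eval (RatFunc.X : RatFunc K) = 0 := by
    rw [← hmap, eval_map_algebraMap, r.minpolyX_aeval_X]
  have hMdvd : M ∣ ((p.map C - C p : K[X][X])).map (algebraMap K[X] (RatFunc K)) := by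
    let Q : (IntermediateField.adjoin K {r})[X] :=
      p.map (algebraMap K _) - C ⟨algebraMap K[X] (RatFunc K) p, hDr ▸ hpD⟩
    have hQ : aeval (RatFunc.X : RatFunc K) Q = 0 := by
      simp only [Q, map_sub, aeval_map_algebraMap, aeval_C]
      rw [RatFunc.aeval_X_left_eq_algebraMap]
      exact sub_self _
    have h1 : r.minpolyX (IntermediateField.adjoin K {r}) ∣ Q := by
      refine dvd_trans ?_ (minpoly.dvd _ _ hQ)
      rw [← minpoly.eq_of_irreducible (r.irreducible_minpolyX hrC) r.minpolyX_aeval_X]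
      exact dvd_mul_right _ _
    rw [← hmap]
    convert Polynomial.map_dvd (algebraMap _ (RatFunc K)) h1 using 1
    ext n
    simp [Q, coeff_C]
  obtain ⟨G, hG⟩ : ∃ G : K[X][X], G.map (algebraMap K[X] (RatFunc K)) * C M.leadingCoeff = M := by
    have hlc : p.leadingCoeff ≠ 0 := leadingCoeff_ne_zero.mpr (by rintro rfl; simp at hp)
    have hdeg : (C p : K[X][X]).degree < (p.map C).degree := by
      rw [degree_map_eq_of_injective C_injective]
      exact degree_C_le.trans_lt (natDegree_pos_iff_degree_pos.mp (Nat.pos_of_ne_zero hp))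
    refine IsIntegrallyClosed.eq_map_mul_C_of_dvd (RatFunc K)
      (f := C (C p.leadingCoeff⁻¹) * (p.map C - C p)) ?_ ?_
    · rw [Monic, leadingCoeff_mul, leadingCoeff_sub_of_degree_lt hdeg, leadingCoeff_C,
        leadingCoeff_map_of_injective C_injective, ← C_mul, inv_mul_cancel₀ hlc, C_1]
    · rw [Polynomial.map_mul]
      exact hMdvd.mul_left _
  have hl : M.leadingCoeff ≠ 0 := leadingCoeff_ne_zero.mpr hM0
  obtain ⟨i, hi⟩ : ∃ i, (G.coeff i).natDegree ≠ 0 := by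
    by_contra! hcon
    obtain ⟨H, rfl⟩ : ∃ H : K[X], H.map C = G := by
      rw [← mem_lifts, lifts_iff_coeff_lifts]
      intro n
      obtain ⟨c, hc⟩ := natDegree_eq_zero.mp (hcon n)
      exact ⟨c, hc⟩
    rw [← hG, eval_mul, eval_C, mul_eq_zero, or_iff_left hl, Polynomial.map_map, eval_map] at hMX
    have : algebraMap K[X] (RatFunc K) H = 0 := by
      rw [← RatFunc.aeval_X_left_eq_algebraMap]
      exact hMX
    rw [(map_eq_zero_iff _ hinj).mp this] at hG
    exact hM0 (by rw [← hG]; simp)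
  have hrel : algebraMap K[X] (RatFunc K) (G.coeff i) * M.leadingCoeff = M.coeff i := by
    conv_rhs => rw [← hG]
    simp
  rw [leadingCoeff] at hl hrel
  rw [hMcoeff] at hl
  rw [hMcoeff, hMcoeff] at hrel
  have hconst (E : IntermediateField K (RatFunc K)) (c : K) :
      algebraMap K[X] (RatFunc K) (C c) ∈ E := by
    rw [← algebraMap_eq, ← IsScalarTower.algebraMap_apply]
    exact E.algebraMap_mem c
  refine ⟨G.coeff i, hi, le_antisymm ?_ ?_⟩
  · rw [hDr, IntermediateField.adjoin_simple_le_iff]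
    set E := IntermediateField.adjoin K {algebraMap K[X] (RatFunc K) (G.coeff i)}
    have hWE : algebraMap K[X] (RatFunc K) (G.coeff i) ∈ E :=
      IntermediateField.mem_adjoin_simple_self _ _
    set W := G.coeff i
    set a := r.num.coeff i
    set b := r.denom.coeff i
    set c := r.num.coeff M.natDegree
    set d := r.denom.coeff M.natDegree
    have hne : algebraMap K[X] (RatFunc K) (C b - C d * W) ≠ 0 := by
      intro h0
      have h1 : C d * W = C b := (sub_eq_zero.mp ((map_eq_zero_iff _ hinj).mp h0)).symm
      obtain ⟨hd, hb⟩ := eq_zero_of_C_mul_eq_C hi h1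
      rw [hd, hb] at hrel
      rw [hd] at hl
      have h2 : C c * W = C a := hinj (by simpa [mul_comm] using hrel)
      obtain ⟨hc, -⟩ := eq_zero_of_C_mul_eq_C hi h2
      rw [hc] at hl
      simp at hl
    have hreq : r = algebraMap K[X] (RatFunc K) (C a - C c * W) /
        algebraMap K[X] (RatFunc K) (C b - C d * W) := by
      rw [eq_div_iff hne]
      simp only [map_sub, map_mul]
      linear_combination hrel
    rw [hreq]
    simp only [map_sub, map_mul]
    exact div_mem (sub_mem (hconst _ _) (mul_mem (hconst _ _) hWE))
      (sub_mem (hconst _ _) (mul_mem (hconst _ _) hWE))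
  · rw [IntermediateField.adjoin_simple_le_iff, eq_div_of_mul_eq hl hrel]
    exact div_mem (sub_mem (hconst _ _) (mul_mem hrD (hconst _ _)))
      (sub_mem (hconst _ _) (mul_mem hrD (hconst _ _)))

/-- The substitution `X ↦ z + t * u` expanded at a point `z`. -/
theorem exists_aeval_add_X_mul_eq {p : ℂ[X]} (hp : 0 < p.natDegree) (z : ℂ) :
    ∃ P : ℂ[X], P.coeff 0 ≠ 0 ∧ ∀ u : PowerSeries ℂ,
      aeval (PowerSeries.C z + PowerSeries.X * u) p = PowerSeries.C (p.eval z) +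
        PowerSeries.X ^ localDeg p z * (u ^ localDeg p z * aeval (PowerSeries.X * u) P) := by
  obtain ⟨P, hP, hPz⟩ := exists_eq_add_pow_localDeg_mul hp z
  refine ⟨P.comp (X + C z), by simpa [coeff_zero_eq_eval_zero, eval_comp] using hPz, fun u ↦ ?_⟩
  have hC (c : ℂ) : algebraMap ℂ (PowerSeries ℂ) c = PowerSeries.C c := rfl
  have hcomp : aeval (PowerSeries.X * u) (P.comp (X + C z)) =
      aeval (PowerSeries.C z + PowerSeries.X * u) P := by
    rw [aeval_comp]
    simp [add_comm]
  conv_lhs => rw [hP]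
  rw [hcomp, map_add, map_mul, map_pow, map_sub, aeval_C, aeval_C, aeval_X, hC, hC,
    add_sub_cancel_left]
  ring

theorem exists_series_aeval_eq {p : ℂ[X]} (hp : 0 < p.natDegree) (z : ℂ) {ζ : ℂ}
    (hζ : ζ ^ localDeg p z = 1) : ∃ u : PowerSeries ℂ, PowerSeries.constantCoeff u = ζ ∧
      aeval (PowerSeries.C z + PowerSeries.X * u) p =
        aeval (PowerSeries.C z + PowerSeries.X * 1) p := by
  obtain ⟨P, hP, h⟩ := exists_aeval_add_X_mul_eq hp z
  obtain ⟨u, hu, hu'⟩ := exists_series_pow_mul_aeval_eq hP (localDeg_pos hp z) hζ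
  refine ⟨u, hu, ?_⟩
  rw [h, h, hu', one_pow, one_mul, mul_one]

theorem series_eq_of_aeval_eq {h : ℂ[X]} (hh : 0 < h.natDegree) {z : ℂ} {u v : PowerSeries ℂ}
    (hu : PowerSeries.constantCoeff u ≠ 0)
    (huv : PowerSeries.constantCoeff u = PowerSeries.constantCoeff v)
    (H : aeval (PowerSeries.C z + PowerSeries.X * u) h =
      aeval (PowerSeries.C z + PowerSeries.X * v) h) : u = v := by
  obtain ⟨P, hP, hexp⟩ := exists_aeval_add_X_mul_eq hh z
  rw [hexp, hexp, add_right_inj] at H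
  exact series_eq_of_pow_mul_aeval_eq hP (localDeg_pos hh z) hu huv
    (mul_left_cancel₀ (pow_ne_zero _ PowerSeries.X_ne_zero) H)

theorem aeval_add_X_mul_injective (z : ℂ) {u : PowerSeries ℂ}
    (hu : PowerSeries.constantCoeff u ≠ 0) :
    Function.Injective (aeval (R := ℂ) (PowerSeries.C z + PowerSeries.X * u)) := by
  have hC (c : ℂ) : algebraMap ℂ (PowerSeries ℂ) c = PowerSeries.C c := rfl
  rw [injective_iff_map_eq_zero]
  intro h hh
  rcases Nat.eq_zero_or_pos h.natDegree with h0 | h0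
  · obtain ⟨c, rfl⟩ := natDegree_eq_zero.mp h0
    rw [aeval_C] at hh
    simpa [hC] using hh
  · obtain ⟨P, hP, hexp⟩ := exists_aeval_add_X_mul_eq h0 z
    rw [hexp] at hh
    have hz : h.eval z = 0 := by
      simpa [(localDeg_pos h0 z).ne'] using congrArg PowerSeries.constantCoeff hh
    rw [hz, map_zero, zero_add, mul_eq_zero, or_iff_right (pow_ne_zero _ PowerSeries.X_ne_zero)]
      at hh
    have := congrArg PowerSeries.constantCoeff hh
    rw [map_mul, map_pow, constantCoeff_aeval_X_mul, map_zero] at this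
    exact absurd this (mul_ne_zero (pow_ne_zero _ hu) hP)

/-- Two embeddings of `K(X)` that agree on polynomials `p` and `q` without nontrivial common
right compositional factor are equal. -/
theorem algHom_eq_of_forall_eq_comp {K L : Type*} [Field K] [CommRing L] [IsDomain L] [Algebra K L]
    {φ ψ : K[X] →ₐ[K] L} (hφ : Function.Injective φ) (hψ : Function.Injective ψ) {p q : K[X]}
    (hp : p.natDegree ≠ 0) (hpq : ∀ p₁ q₁ W : K[X], p = p₁.comp W → q = q₁.comp W →
      W.natDegree ≤ 1) (h₁ : φ p = ψ p) (h₂ : φ q = ψ q) : φ = ψ := by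
  let i : L →ₐ[K] FractionRing L := IsScalarTower.toAlgHom K L (FractionRing L)
  have hi : Function.Injective i := IsFractionRing.injective L (FractionRing L)
  let σ : RatFunc K →ₐ[K] FractionRing L :=
    IsFractionRing.liftAlgHom (A := K[X]) (g := i.comp φ) (hi.comp hφ)
  let τ : RatFunc K →ₐ[K] FractionRing L :=
    IsFractionRing.liftAlgHom (A := K[X]) (g := i.comp ψ) (hi.comp hψ)
  have hσ (s : K[X]) : σ (algebraMap K[X] (RatFunc K) s) = i (φ s) :=
    IsFractionRing.lift_algebraMap (A := K[X]) (g := (i.comp φ).toRingHom) (hi.comp hφ) s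
  have hτ (s : K[X]) : τ (algebraMap K[X] (RatFunc K) s) = i (ψ s) :=
    IsFractionRing.lift_algebraMap (A := K[X]) (g := (i.comp ψ).toRingHom) (hi.comp hψ) s
  let D : IntermediateField K (RatFunc K) :=
    { AlgHom.equalizer σ τ with
      inv_mem' := fun x hx ↦ by
        have hx : σ x = τ x := hx
        change σ x⁻¹ = τ x⁻¹
        rw [map_inv₀, map_inv₀, hx] }
  have hD (s : K[X]) : algebraMap K[X] (RatFunc K) s ∈ D ↔ φ s = ψ s := by
    change σ _ = τ _ ↔ _
    rw [hσ, hτ, hi.eq_iff]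
  obtain ⟨W, hW, hDW⟩ := exists_polynomial_eq_adjoin D hp ((hD p).mpr h₁)
  obtain ⟨p₁, hp₁⟩ := exists_eq_comp_of_mem_adjoin hW (hDW ▸ (hD p).mpr h₁)
  obtain ⟨q₁, hq₁⟩ := exists_eq_comp_of_mem_adjoin hW (hDW ▸ (hD q).mpr h₂)
  have hW1 : W.natDegree = 1 := by have := hpq p₁ q₁ W hp₁ hq₁; lia
  obtain ⟨a, ha, b, rfl⟩ := natDegree_eq_one.mp hW1
  have hWD : φ (C a * X + C b) = ψ (C a * X + C b) :=
    (hD _).mp (hDW ▸ IntermediateField.mem_adjoin_simple_self _ _)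
  have hC (c : K) : φ (C c) = ψ (C c) := by
    rw [← algebraMap_eq, φ.commutes, ψ.commutes]
  rw [map_add, map_add, map_mul, map_mul, hC a, hC b, add_left_inj] at hWD
  refine Polynomial.algHom_ext (mul_left_cancel₀ ?_ hWD)
  rw [← map_zero ψ]
  exact hψ.ne (C_ne_zero.mpr ha)

/-- If `p` and `q` have no nontrivial common right compositional factor and `f ∘ p = g ∘ q`,
then the local degrees of `p` and `q` at every point are coprime. -/
theorem coprime_localDeg {f g p q : ℂ[X]} (hf : 0 < f.natDegree)
    (hp : 0 < p.natDegree) (hq : 0 < q.natDegree) (heq : f.comp p = g.comp q)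
    (hnc : NoCommonRightFactor p q) (z : ℂ) : Nat.Coprime (localDeg p z) (localDeg q z) := by
  set d := Nat.gcd (localDeg p z) (localDeg q z) with hd
  have hd0 : d ≠ 0 := (Nat.gcd_pos_of_pos_left _ (localDeg_pos hp z)).ne'
  have hζ := Complex.isPrimitiveRoot_exp d hd0
  set ζ := Complex.exp (2 * Real.pi * Complex.I / d)
  have hζ0 : ζ ≠ 0 := hζ.ne_zero hd0
  obtain ⟨u, hu, hup⟩ := exists_series_aeval_eq hp z
    ((hζ.pow_eq_one_iff_dvd _).mpr (Nat.gcd_dvd_left _ (localDeg q z)))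
  obtain ⟨v, hv, hvq⟩ := exists_series_aeval_eq hq z
    ((hζ.pow_eq_one_iff_dvd _).mpr (Nat.gcd_dvd_right (localDeg p z) _))
  have hh : 0 < (f.comp p).natDegree := by
    rw [natDegree_comp]
    exact Nat.mul_pos hf hp
  obtain rfl : u = v := by
    refine series_eq_of_aeval_eq hh (z := z) (hu ▸ hζ0) (hu.trans hv.symm) ?_
    rw [aeval_comp, hup, ← aeval_comp, heq, aeval_comp, aeval_comp, hvq]
  have h := algHom_eq_of_forall_eq_comp (aeval_add_X_mul_injective z (hu ▸ hζ0))
    (aeval_add_X_mul_injective z (u := 1) (by simp)) hp.ne' hnc hup hvq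
  have hX := DFunLike.congr_fun h X
  rw [aeval_X, aeval_X, add_right_inj] at hX
  obtain rfl : u = 1 := mul_left_cancel₀ PowerSeries.X_ne_zero hX
  rw [map_one] at hu
  rw [← hu] at hζ
  exact hζ.unique .one

/-- If `F` is irreducible over an integrally closed domain `R` and `s` is an integral root of `F`
in an extension of `R`, then every other polynomial over `R` vanishing at `s` is a multiple
of `F`. -/
theorem dvd_of_eval₂_eq_zero_of_irreducible {R S : Type*} [CommRing R] [IsDomain R]
    [IsIntegrallyClosed R] [CommRing S] [IsDomain S] {φ : R →+* S} (hφ : Function.Injective φ)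
    {s : S} (hs : φ.IsIntegralElem s) {F G : R[X]} (hF : Irreducible F)
    (hFs : F.eval₂ φ s = 0) (hGs : G.eval₂ φ s = 0) : F ∣ G := by
  let := φ.toAlgebra
  have : Module.IsTorsionFree R S :=
    (faithfulSMul_iff_algebraMap_injective R S).mpr hφ |>.to_isTorsionFree R S
  have hs : IsIntegral R s := hs
  have h1 : minpoly R s ∣ F := minpoly.isIntegrallyClosed_dvd hs hFs
  have h2 : minpoly R s ∣ G := minpoly.isIntegrallyClosed_dvd hs hGs
  exact ((hF.dvd_iff.mp h1).resolve_left (minpoly.not_isUnit R s)).dvd.trans h2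

theorem isIntegral_compRingHom {K : Type*} [Field K] {p : K[X]} (hp : p.natDegree ≠ 0) :
    (compRingHom p).IsIntegral := by
  have hC (c : K) : (compRingHom p).IsIntegralElem (C c) := by
    simpa using (compRingHom p).isIntegralElem_map (x := C c)
  have hX : (compRingHom p).IsIntegralElem X := by
    have hlc : p.leadingCoeff ≠ 0 := leadingCoeff_ne_zero.mpr (by rintro rfl; simp at hp)
    have hdeg : (C X : K[X][X]).degree < (p.map C).degree := by
      rw [degree_map_eq_of_injective C_injective]
      exact degree_C_le.trans_lt (natDegree_pos_iff_degree_pos.mp (Nat.pos_of_ne_zero hp))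
    refine ⟨C (C p.leadingCoeff⁻¹) * (p.map C - C X), ?_, ?_⟩
    · rw [Monic, leadingCoeff_mul, leadingCoeff_sub_of_degree_lt hdeg, leadingCoeff_C,
        leadingCoeff_map_of_injective C_injective, ← C_mul, inv_mul_cancel₀ hlc, C_1]
    · have hcomp : (compRingHom p).comp C = C := by ext; simp
      rw [eval₂_mul, eval₂_sub, eval₂_map, hcomp, eval₂_C_X]
      simp
  intro h
  induction h using Polynomial.induction_on with
  | C c => exact hC c
  | add h₁ h₂ ih₁ ih₂ => exact ih₁.add _ ih₂
  | monomial n c ih =>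
    rw [pow_succ, ← mul_assoc]
    exact ih.mul _ hX

/-- If `f ∘ p = g ∘ q` and `f(X) - g(Y)` is irreducible, then `z ↦ (p z, q z)` maps onto the
curve `f(x) = g(y)`. -/
theorem exists_eval_eq_and_eval_eq {f g p q : ℂ[X]} (hp : p.natDegree ≠ 0)
    (heq : f.comp p = g.comp q) (hirr : Irreducible (curvePoly f g)) {x y : ℂ}
    (hxy : f.eval x = g.eval y) : ∃ z, p.eval z = x ∧ q.eval z = y := by
  by_contra! hcon
  have hint := isIntegral_compRingHom hp
  have hinj : Function.Injective (compRingHom p) := by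
    rw [injective_iff_map_eq_zero]
    intro h hh
    rw [coe_compRingHom_apply, comp_eq_zero_iff] at hh
    rcases hh with hh | ⟨-, hh⟩
    · exact hh
    · exact absurd (by rw [hh, natDegree_C]) hp
  let Φ : ℂ[X][X] →+* ℂ[X] := eval₂RingHom (compRingHom p) q
  let ev : ℂ[X][X] →+* ℂ := eval₂RingHom (evalRingHom x) y
  have hΦC (h : ℂ[X]) : Φ (C h) = h.comp p := by simp [Φ]
  have hΦX : Φ X = q := by simp [Φ]
  have hmap (h : ℂ[X]) : Φ (h.map C) = h.comp q := by
    simp only [Φ, coe_eval₂RingHom, eval₂_map]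
    rw [comp]
    congr 1
    ext; simp
  have hevmap (h : ℂ[X]) : ev (h.map C) = h.eval y := by
    simp only [ev, coe_eval₂RingHom, eval₂_map]
    rw [eval]
    congr 1
    ext; simp
  have hcurve : Φ (curvePoly f g) = 0 := by
    rw [curvePoly, map_sub, hΦC, hmap, heq, sub_self]
  have hcurve' : ev (curvePoly f g) = 0 := by
    rw [curvePoly, map_sub, hevmap]
    simp [ev, hxy]
  have hker : RingHom.ker Φ ≤ RingHom.ker ev := by
    intro G hG
    obtain ⟨A, rfl⟩ := dvd_of_eval₂_eq_zero_of_irreducible hinj (hint q) hirr hcurve hG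
    rw [RingHom.mem_ker, map_mul, hcurve', zero_mul]
  have hΦint : Φ.IsIntegral := by
    refine RingHom.IsIntegral.tower_top C Φ ?_
    have hcomp : Φ.comp C = compRingHom p := by ext <;> simp [Φ]
    exact hcomp ▸ hint
  have htop : (RingHom.ker ev).map Φ = ⊤ := by
    have hco : IsCoprime (p - C x) (q - C y) := by
      rw [isCoprime_iff_aeval_ne_zero_of_isAlgClosed ℂ ℂ]
      intro z
      by_contra! h
      simp only [map_sub, coe_aeval_eq_eval, eval_C, sub_eq_zero] at h
      exact hcon z h.1 h.2
    have hp' : p - C x ∈ (RingHom.ker ev).map Φ := by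
      convert Ideal.mem_map_of_mem Φ (x := C (X - C x)) (I := RingHom.ker ev) ?_
      · rw [hΦC]; simp
      · simp [RingHom.mem_ker, ev]
    have hq' : q - C y ∈ (RingHom.ker ev).map Φ := by
      convert Ideal.mem_map_of_mem Φ (x := X - C (C y)) (I := RingHom.ker ev) ?_
      · rw [map_sub, hΦX, hΦC, C_comp]
      · simp [RingHom.mem_ker, ev]
    obtain ⟨α, β, h⟩ := hco
    rw [Ideal.eq_top_iff_one, ← h]
    exact add_mem (Ideal.mul_mem_left _ _ hp') (Ideal.mul_mem_left _ _ hq')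
  rw [Ideal.map_eq_top_iff_of_ker_le Φ hker hΦint] at htop
  exact RingHom.ker_ne_top ev htop

theorem div_eq_div_mul_gcd_of_mul_eq_lcm {a b d e N m : ℕ} (ha : 0 < a) (hb : 0 < b)
    (haN : a ∣ N) (hade : a * d = b * e) (hde : Nat.Coprime d e)
    (hm : m * b = Nat.lcm N b) :
    N / a = m / e * Nat.gcd d (N / a) := by
  obtain ⟨k, rfl⟩ := haN
  rw [Nat.mul_div_cancel_left _ ha]
  obtain ⟨c, rfl⟩ : d ∣ b := hde.dvd_of_dvd_mul_right (hade ▸ dvd_mul_left d a)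
  have hd : 0 < d := Nat.pos_of_mul_pos_right hb
  have hc : 0 < c := Nat.pos_of_mul_pos_left hb
  obtain rfl : a = c * e := Nat.eq_of_mul_eq_mul_right hd (by rw [hade]; ring)
  have he : 0 < e := Nat.pos_of_mul_pos_left ha
  have h1 : m * d = Nat.lcm (e * k) d := by
    apply Nat.eq_of_mul_eq_mul_left hc
    rw [← Nat.lcm_mul_left, ← mul_assoc c e k, mul_comm c d, ← hm]
    ring
  have h2 : Nat.gcd (e * k) d = Nat.gcd d k := by
    rw [Nat.gcd_comm, Nat.Coprime.gcd_mul_left_cancel_right k hde.symm]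
  have h3 : m * Nat.gcd d k = e * k := by
    apply Nat.eq_of_mul_eq_mul_right hd
    rw [← Nat.gcd_mul_lcm (e * k) d, ← h1, h2]
    ring
  obtain ⟨n, rfl⟩ : e ∣ m :=
    (hde.symm.coprime_dvd_right (Nat.gcd_dvd_left d k)).dvd_of_dvd_mul_right (h3 ▸ dvd_mul_right e k)
  rw [Nat.mul_div_cancel_left _ he]
  exact Nat.eq_of_mul_eq_mul_left he (by rw [← h3, mul_assoc])

theorem mul_eq_lcm_of_coprime {a b d e : ℕ} (hb : 0 < b) (hade : a * d = b * e)
    (hde : Nat.Coprime d e) : b * e = Nat.lcm a b := by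
  obtain ⟨c, rfl⟩ : d ∣ b := hde.dvd_of_dvd_mul_right (hade ▸ dvd_mul_left d a)
  obtain rfl : a = c * e :=
    Nat.eq_of_mul_eq_mul_right (Nat.pos_of_mul_pos_right hb) (by rw [hade]; ring)
  rw [mul_comm d c, Nat.lcm_mul_left, hde.symm.lcm_eq_mul]
  ring

theorem mem_roots_toFinset_sub_C_iff {h : ℂ[X]} (hh : 0 < h.natDegree) {w u : ℂ} :
    u ∈ (h - C w).roots.toFinset ↔ h.eval u = w := by
  have : h - C w ≠ 0 := by
    intro h0
    rw [sub_eq_zero.mp h0, natDegree_C] at hh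
    exact hh.false
  simp [this, sub_eq_zero]

theorem localDeg_dvd_nuPoly {h : ℂ[X]} (hh : 0 < h.natDegree) {w u : ℂ} (hu : h.eval u = w) :
    localDeg h u ∣ nuPoly h w :=
  Finset.dvd_lcm ((mem_roots_toFinset_sub_C_iff hh).mpr hu)

theorem nuPoly_dvd {h : ℂ[X]} (hh : 0 < h.natDegree) {w : ℂ} {n : ℕ}
    (H : ∀ u, h.eval u = w → localDeg h u ∣ n) : nuPoly h w ∣ n :=
  Finset.lcm_dvd fun u hu ↦ H u ((mem_roots_toFinset_sub_C_iff hh).mp hu)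

theorem nuPoly_mul_localDeg_eq_lcm {f g p q : ℂ[X]} (hf : 0 < f.natDegree) (hg : 0 < g.natDegree)
    (hp : 0 < p.natDegree) (hq : 0 < q.natDegree) (heq : f.comp p = g.comp q)
    (hirr : Irreducible (curvePoly f g))
    (hcop : ∀ z, Nat.Coprime (localDeg p z) (localDeg q z)) {y w : ℂ} (hy : g.eval y = w) :
    nuPoly q y * localDeg g y = Nat.lcm (nuPoly f w) (localDeg g y) := by
  have hmul (z : ℂ) (hz : q.eval z = y) :
      localDeg f (p.eval z) * localDeg p z = localDeg g y * localDeg q z := by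
    rw [← hz, ← localDeg_comp hf hp, heq, localDeg_comp hg hq]
  have hb := localDeg_pos hg y
  apply Nat.dvd_antisymm
  · obtain ⟨n, hn⟩ := Nat.dvd_lcm_right (nuPoly f w) (localDeg g y)
    rw [hn, mul_comm]
    refine mul_dvd_mul_left _ (nuPoly_dvd hq fun z hz ↦ ?_)
    rw [← Nat.mul_dvd_mul_iff_left hb, ← hn]
    have hw : f.eval (p.eval z) = w := by rw [← eval_comp, heq, eval_comp, hz, hy]
    rw [mul_eq_lcm_of_coprime hb (hmul z hz) (hcop z)]
    exact Nat.lcm_dvd ((localDeg_dvd_nuPoly hf hw).trans (Nat.dvd_lcm_left _ _))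
      (Nat.dvd_lcm_right _ _)
  · refine Nat.lcm_dvd (nuPoly_dvd hf fun x hx ↦ ?_) (dvd_mul_left _ _)
    obtain ⟨z, rfl, hz⟩ := exists_eval_eq_and_eval_eq hp.ne' heq hirr (hx.trans hy.symm)
    refine (Dvd.intro _ (hmul z hz)).trans ?_
    rw [mul_comm]
    exact mul_dvd_mul_right (localDeg_dvd_nuPoly hq hz) _

theorem stmt_17 (f g p q : Polynomial ℂ)
    (hf : 0 < f.natDegree) (hg : 0 < g.natDegree)
    (hp : 0 < p.natDegree) (hq : 0 < q.natDegree)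
    (heq : f.comp p = g.comp q)
    (hirr : Irreducible (curvePoly f g))
    (hnc : NoCommonRightFactor p q) :
    ∀ z : ℂ,
      nuOnePoly f (p.eval z) =
        nuOnePoly q z * Nat.gcd (localDeg p z) (nuOnePoly f (p.eval z)) := by
  intro z
  have hcop := coprime_localDeg hf hp hq heq hnc
  have hw : g.eval (q.eval z) = f.eval (p.eval z) := by
    rw [← eval_comp, ← eval_comp, heq]
  refine div_eq_div_mul_gcd_of_mul_eq_lcm (localDeg_pos hf _) (localDeg_pos hg (q.eval z))
    (localDeg_dvd_nuPoly hf rfl) ?_ (hcop z)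
    (nuPoly_mul_localDeg_eq_lcm hf hg hp hq heq hirr hcop hw)
  rw [← localDeg_comp hf hp, heq, localDeg_comp hg hq]
end
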